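/- Let f ∈ E, ε > 0, and let V ⊆ H be a closed subspace containing the range of U ∘ P, with orthogonal projection Q onto V. Suppose h_ε ∈ E satisfies ‖U(P h_ε) − Q(U f)‖² < ε/2, and let 0 < α < ε/(2‖h_ε‖²). Then the global minimizer h(α) of the functional h ↦ ‖U(Ph) − U f‖² + α‖h‖² satisfies ‖U(P h(α)) − Q(U f)‖² ≤ ε. (Quantitative estimate (22')–(F-estimate 2) from the proof of Lemma 8 of the paper.) -/

import Mathlib

open RealInnerProductSpace

/-- Pythagoras for a point `v` of a subspace, `w` and a point `q` with `w - q` orthogonal to it. -/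
theorem Submodule.norm_sub_sq_eq_of_sub_mem_orthogonal
    {H : Type*} [NormedAddCommGroup H] [InnerProductSpace ℝ H] {V : Submodule ℝ H} {v q w : H}
    (hv : v ∈ V) (hq : q ∈ V) (hw : w - q ∈ Vᗮ) :
    ‖v - w‖ ^ 2 = ‖v - q‖ ^ 2 + ‖w - q‖ ^ 2 := by
  have horth : ⟪v - q, w - q⟫ = 0 := V.inner_right_of_mem_orthogonal (V.sub_mem hv hq) hw
  rw [← sub_sub_sub_cancel_right v w q, norm_sub_sq_real, horth]
  ring

/-- Quantitative estimate (22')–(F-estimate 2) from the proof of Lemma 8 of the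
paper: if `V` is a closed subspace containing the range of `U ∘ P` with orthogonal
projection `Q`, `h_ε` satisfies `‖U(P h_ε) − Q(U f)‖² < ε/2`, and
`0 < α < ε/(2‖h_ε‖²)`, then the global minimizer `h(α)` of
`h ↦ ‖U(Ph) − U f‖² + α‖h‖²` satisfies `‖U(P h(α)) − Q(U f)‖² ≤ ε`. -/
theorem processed_time_reversal_quantitative_estimate
    {E H : Type*} [NormedAddCommGroup E] [InnerProductSpace ℝ E] [CompleteSpace E]
    [NormedAddCommGroup H] [InnerProductSpace ℝ H] [CompleteSpace H]
    (U : E →L[ℝ] H) (P : E →L[ℝ] E)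
    (hP_idem : ∀ x : E, P (P x) = P x)
    (hP_selfadj : ∀ x y : E, ⟪P x, y⟫ = ⟪x, P y⟫)
    (V : Submodule ℝ H) (hVclosed : IsClosed (V : Set H))
    (hVrange : ∀ x : E, U (P x) ∈ V)
    (Q : H →L[ℝ] H)
    (hQ : ∀ y : H, Q y ∈ V ∧ y - Q y ∈ Vᗮ)
    (f : E) (ε : ℝ) (hε : 0 < ε)
    (hEps : E) (hhEps : ‖U (P hEps) - Q (U f)‖ ^ 2 < ε / 2)
    (α : ℝ) (hα : 0 < α) (hα' : α < ε / (2 * ‖hEps‖ ^ 2))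
    (hmin : E)
    (hglobal : ∀ h' : E,
      ‖U (P hmin) - U f‖ ^ 2 + α * ‖hmin‖ ^ 2 ≤
        ‖U (P h') - U f‖ ^ 2 + α * ‖h'‖ ^ 2) :
    ‖U (P hmin) - Q (U f)‖ ^ 2 ≤ ε := by
  have pythagoras (x : E) :
      ‖U (P x) - U f‖ ^ 2 = ‖U (P x) - Q (U f)‖ ^ 2 + ‖U f - Q (U f)‖ ^ 2 :=
    Submodule.norm_sub_sq_eq_of_sub_mem_orthogonal (hVrange x) (hQ (U f)).1 (hQ (U f)).2
  have hcomp := hglobal hEps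
  rw [pythagoras, pythagoras] at hcomp
  have hnorm : 0 < 2 * ‖hEps‖ ^ 2 := by
    by_contra! hle
    exact absurd (hα.trans hα') (div_nonpos_of_nonneg_of_nonpos hε.le hle).not_gt
  have hpenalty := (lt_div_iff₀ hnorm).1 hα'
  have hmin_nonneg : 0 ≤ α * ‖hmin‖ ^ 2 := by positivity
  linarith
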